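/- As n and m tend to infinity, (1/(nm)) · Σ_{k=1}^{n} Σ_{l=1}^{m} log(4 + 2cos(kπ/(n+1)) + 2cos(lπ/(m+1))) converges to (1/π²) ∫₀^π ∫₀^π log(4 + 2cos x + 2cos y) dx dy; that is, for every ε > 0 there exists N₀ such that the sum differs from the integral by less than ε whenever n ≥ N₀ and m ≥ N₀. -/

import Mathlib

open scoped Real

open Set Filter Topology MeasureTheory

/-- The Riemann sum of `φ` over the interior points of the uniform partition of `[0, π]` into
`n + 1` pieces. -/
noncomputable def riemannSum (φ : ℝ → ℝ) (n : ℕ) : ℝ :=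
  π / (n + 1) * ∑ k ∈ Finset.Icc 1 n, φ (k * π / (n + 1))

/-- An error bound for the Riemann sums of antitone functions on `[0, π]` lying between `w`
and `C`. -/
noncomputable def riemannError (w : ℝ → ℝ) (C : ℝ) (n : ℕ) : ℝ :=
  |∫ y in (n * π / (n + 1))..π, w y| + π / (n + 1) * |C|

lemma node_mem_Ioo {n k : ℕ} (hk : k ∈ Finset.Icc 1 n) :
    (k : ℝ) * π / (n + 1) ∈ Ioo 0 π := by
  rw [Finset.mem_Icc] at hk
  have hk1 : (0 : ℝ) < k := by exact_mod_cast hk.1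
  have hk2 : (k : ℝ) ≤ n := by exact_mod_cast hk.2
  refine ⟨by positivity, ?_⟩
  rw [div_lt_iff₀ (by positivity)]
  nlinarith [Real.pi_pos]

lemma sum_node_eq_sum_range (φ : ℝ → ℝ) (n : ℕ) :
    ∑ k ∈ Finset.Icc 1 n, φ (k * π / (n + 1)) =
      ∑ i ∈ Finset.range n, φ (((i + 1 : ℕ) : ℝ) * (π / (n + 1))) := by
  rw [← Finset.Ico_add_one_right_eq_Icc, Finset.sum_Ico_eq_sum_range]
  refine Finset.sum_congr (by simp) fun i _ ↦ ?_
  rw [mul_div_assoc, add_comm 1 i]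

lemma abs_riemannSum_sub_riemannSum_le {φ ψ : ℝ → ℝ} {δ : ℝ}
    (h : ∀ x ∈ Ioo 0 π, |φ x - ψ x| ≤ δ) (n : ℕ) :
    |riemannSum φ n - riemannSum ψ n| ≤ π * δ := by
  have hδ : 0 ≤ δ :=
    (abs_nonneg _).trans (h (π / 2) ⟨by positivity, by linarith [Real.pi_pos]⟩)
  rw [riemannSum, riemannSum, ← mul_sub, ← Finset.sum_sub_distrib, abs_mul,
    abs_of_pos (by positivity : 0 < π / ((n : ℝ) + 1))]
  calc _ ≤ π / (n + 1) * (n * δ) := by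
        gcongr
        refine (Finset.abs_sum_le_sum_abs _ _).trans ?_
        refine (Finset.sum_le_sum fun k hk ↦ h _ (node_mem_Ioo hk)).trans ?_
        simp
    _ = π * δ * (n / (n + 1)) := by ring
    _ ≤ π * δ * 1 := by
        gcongr
        rw [div_le_one (by positivity)]
        linarith
    _ = π * δ := mul_one _

lemma AntitoneOn.abs_riemannSum_sub_integral_le {φ w : ℝ → ℝ} {C : ℝ}
    (hφ : AntitoneOn φ (Icc 0 π)) (hC : ∀ x ∈ Ioo 0 π, φ x ≤ C)
    (hw : IntervalIntegrable w volume 0 π) (hwφ : ∀ x ∈ Ioo 0 π, w x ≤ φ x) (n : ℕ) :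
    |riemannSum φ n - ∫ x in 0..π, φ x| ≤ riemannError w C n := by
  have hpi := Real.pi_pos
  have hh : 0 < π / ((n : ℝ) + 1) := by positivity
  set h : ℝ := π / (n + 1) with h_def
  have hnh : ((n : ℝ) + 1) * h = π := by rw [h_def]; field_simp
  have hb : (n : ℝ) * π / (n + 1) = n * h := by rw [h_def]; ring
  have hb0 : 0 ≤ (n : ℝ) * h := by positivity
  have hbπ : (n : ℝ) * h ≤ π := by linarith
  have hhπ : h ≤ π := by linarith
  have hanti : AntitoneOn (fun t ↦ φ (t * h)) (Icc 0 (n + 1)) := by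
    intro s hs t ht hst
    refine hφ ⟨mul_nonneg hs.1 hh.le, ?_⟩ ⟨mul_nonneg ht.1 hh.le, ?_⟩ (by gcongr)
    · rw [← hnh]; gcongr; exact hs.2
    · rw [← hnh]; gcongr; exact ht.2
  have hint : ∀ a ∈ Icc 0 π, ∀ b ∈ Icc 0 π, IntervalIntegrable φ volume a b := by
    intro a ha b hb
    exact (hφ.mono (uIcc_subset_Icc ha hb)).intervalIntegrable
  have upper : riemannSum φ n ≤ ∫ x in 0..(n * h), φ x := by
    have key : ∑ i ∈ Finset.range n, φ ((0 + ((i + 1 : ℕ) : ℝ)) * h) ≤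
        ∫ x in (0 : ℝ)..0 + n, φ (x * h) :=
      AntitoneOn.sum_le_integral (f := fun t ↦ φ (t * h))
        (hanti.mono (Icc_subset_Icc le_rfl (by linarith)))
    rw [intervalIntegral.integral_comp_mul_right _ hh.ne', smul_eq_mul] at key
    simp only [zero_add, zero_mul] at key
    rw [riemannSum, sum_node_eq_sum_range, ← h_def]
    calc _ ≤ h * (h⁻¹ * ∫ x in 0..(n * h), φ x) := by gcongr
      _ = _ := mul_inv_cancel_left₀ hh.ne' _
  have lower : ∫ x in h..π, φ x ≤ riemannSum φ n := by
    have key : ∫ x in (1 : ℝ)..1 + n, φ (x * h) ≤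
        ∑ i ∈ Finset.range n, φ ((1 + (i : ℝ)) * h) :=
      AntitoneOn.integral_le_sum (f := fun t ↦ φ (t * h))
        (hanti.mono (Icc_subset_Icc zero_le_one (by linarith)))
    rw [intervalIntegral.integral_comp_mul_right _ hh.ne', smul_eq_mul, one_mul,
      add_comm (1 : ℝ), hnh] at key
    rw [riemannSum, sum_node_eq_sum_range, ← h_def]
    calc _ = h * (h⁻¹ * ∫ x in h..π, φ x) := (mul_inv_cancel_left₀ hh.ne' _).symm
      _ ≤ _ := by
        gcongr
        refine key.trans_eq (Finset.sum_congr rfl fun i _ ↦ ?_)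
        rw [Nat.cast_add_one, add_comm]
  have split_b := intervalIntegral.integral_add_adjacent_intervals
    (hint 0 ⟨le_rfl, hpi.le⟩ _ ⟨hb0, hbπ⟩) (hint _ ⟨hb0, hbπ⟩ π ⟨hpi.le, le_rfl⟩)
  have split_h := intervalIntegral.integral_add_adjacent_intervals
    (hint 0 ⟨le_rfl, hpi.le⟩ _ ⟨hh.le, hhπ⟩) (hint _ ⟨hh.le, hhπ⟩ π ⟨hpi.le, le_rfl⟩)
  have near_zero : ∫ x in 0..h, φ x ≤ h * C := by
    calc _ ≤ ∫ _ in 0..h, C :=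
          intervalIntegral.integral_mono_on_of_le_Ioo hh.le
            (hint 0 ⟨le_rfl, hpi.le⟩ _ ⟨hh.le, hhπ⟩) intervalIntegrable_const
            fun x hx ↦ hC x ⟨hx.1, hx.2.trans_le hhπ⟩
      _ = h * C := by simp
  have near_pi : ∫ x in (n * h)..π, w x ≤ ∫ x in (n * h)..π, φ x := by
    refine intervalIntegral.integral_mono_on_of_le_Ioo hbπ (hw.mono_set ?_)
      (hint _ ⟨hb0, hbπ⟩ π ⟨hpi.le, le_rfl⟩) fun x hx ↦ hwφ x ⟨hb0.trans_lt hx.1, hx.2⟩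
    rw [uIcc_of_le hbπ, uIcc_of_le hpi.le]
    exact Icc_subset_Icc hb0 le_rfl
  rw [riemannError, hb, ← h_def, abs_le]
  have hC' : h * C ≤ h * |C| := by gcongr; exact le_abs_self C
  have hC0 : 0 ≤ h * |C| := by positivity
  have := neg_abs_le (∫ x in (n * h)..π, w x)
  have := abs_nonneg (∫ x in (n * h)..π, w x)
  constructor <;> linarith

lemma tendsto_riemannError {w : ℝ → ℝ} (hw : IntervalIntegrable w volume 0 π) (C : ℝ) :
    Tendsto (riemannError w C) atTop (𝓝 0) := by
  have hpi := Real.pi_pos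
  have hnode : Tendsto (fun n : ℕ ↦ (n : ℝ) * π / (n + 1)) atTop (𝓝[uIcc 0 π] π) := by
    refine tendsto_nhdsWithin_iff.2 ⟨?_, Eventually.of_forall fun n ↦ ?_⟩
    · have := (tendsto_natCast_div_add_atTop (1 : ℝ)).mul_const π
      rw [one_mul] at this
      exact this.congr fun n ↦ by ring
    · rw [uIcc_of_le hpi.le]
      refine ⟨by positivity, ?_⟩
      rw [div_le_iff₀ (by positivity)]
      nlinarith
  have hcont : ContinuousOn (fun b ↦ ∫ y in π..b, w y) (uIcc 0 π) :=
    intervalIntegral.continuousOn_primitive_interval' hw right_mem_uIcc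
  have h1 : Tendsto (fun n : ℕ ↦ |∫ y in (n * π / (n + 1))..π, w y|) atTop (𝓝 0) := by
    have := ((hcont π right_mem_uIcc).tendsto.comp hnode).abs
    simp only [intervalIntegral.integral_same, abs_zero] at this
    refine this.congr fun n ↦ ?_
    rw [Function.comp_apply, intervalIntegral.integral_symm, abs_neg]
  have h2 : Tendsto (fun n : ℕ ↦ π / (n + 1) * |C|) atTop (𝓝 0) := by
    have := (tendsto_one_div_add_atTop_nhds_zero_nat (𝕜 := ℝ)).const_mul (π * |C|)
    rw [mul_zero] at this
    exact this.congr fun n ↦ by ring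
  rw [← add_zero (0 : ℝ)]
  exact h1.add h2

lemma neg_one_lt_cos_of_mem_Ico {x : ℝ} (hx : x ∈ Ico 0 π) : -1 < Real.cos x := by
  rw [← Real.cos_pi]
  exact Real.cos_lt_cos_of_nonneg_of_le_pi hx.1 le_rfl hx.2

lemma antitoneOn_cos : AntitoneOn Real.cos (Icc 0 π) := Real.strictAntiOn_cos.antitoneOn

/-- The integrand of the free energy. -/
noncomputable def logSymbol (x y : ℝ) : ℝ := Real.log (4 + 2 * Real.cos x + 2 * Real.cos y)

lemma logSymbol_le_log_eight {x y : ℝ} (h : -1 < Real.cos x ∨ -1 < Real.cos y) :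
    logSymbol x y ≤ Real.log 8 := by
  have := Real.neg_one_le_cos x
  have := Real.neg_one_le_cos y
  refine Real.log_le_log ?_ (by linarith [Real.cos_le_one x, Real.cos_le_one y])
  rcases h with h | h <;> linarith

lemma antitoneOn_logSymbol_right {x : ℝ} (hx : x ∈ Ico 0 π) :
    AntitoneOn (logSymbol x) (Icc 0 π) := by
  intro y hy z hz hyz
  have := neg_one_lt_cos_of_mem_Ico hx
  have := antitoneOn_cos hy hz hyz
  exact Real.log_le_log (by linarith [Real.neg_one_le_cos z]) (by linarith)

lemma antitoneOn_logSymbol_left {y : ℝ} (hy : y ∈ Ico 0 π) :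
    AntitoneOn (fun x ↦ logSymbol x y) (Icc 0 π) := by
  intro x hx z hz hxz
  have := neg_one_lt_cos_of_mem_Ico hy
  have := antitoneOn_cos hx hz hxz
  exact Real.log_le_log (by linarith [Real.neg_one_le_cos z]) (by linarith)

lemma intervalIntegrable_logSymbol (x a b : ℝ) :
    IntervalIntegrable (logSymbol x) volume a b := by
  have : AnalyticOnNhd ℝ (fun y ↦ 4 + 2 * Real.cos x + 2 * Real.cos y) univ := by
    intro y _
    fun_prop
  exact (this.meromorphicOn.mono_set (subset_univ _)).intervalIntegrable_log

lemma antitoneOn_integral_logSymbol :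
    AntitoneOn (fun x ↦ ∫ y in 0..π, logSymbol x y) (Icc 0 π) := fun _ hx _ hz hxz ↦
  intervalIntegral.integral_mono_on_of_le_Ioo Real.pi_pos.le (intervalIntegrable_logSymbol _ _ _)
    (intervalIntegrable_logSymbol _ _ _) fun _ hy ↦
      antitoneOn_logSymbol_left (Ioo_subset_Ico_self hy) hx hz hxz

lemma tendsto_riemannSum_riemannSum_logSymbol :
    Tendsto (fun p : ℕ × ℕ ↦ riemannSum (fun x ↦ riemannSum (logSymbol x) p.2) p.1)
      (atTop ×ˢ atTop) (𝓝 (∫ x in 0..π, ∫ y in 0..π, logSymbol x y)) := by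
  have hpi := Real.pi_pos
  set g : ℝ → ℝ := fun x ↦ ∫ y in 0..π, logSymbol x y
  have inner : ∀ m, ∀ x ∈ Ioo 0 π,
      |riemannSum (logSymbol x) m - g x| ≤ riemannError (logSymbol π) (Real.log 8) m := by
    intro m x hx
    refine (antitoneOn_logSymbol_right (Ioo_subset_Ico_self hx)).abs_riemannSum_sub_integral_le
      (fun y _ ↦ logSymbol_le_log_eight
        (.inl (neg_one_lt_cos_of_mem_Ico (Ioo_subset_Ico_self hx))))
      (intervalIntegrable_logSymbol _ _ _) (fun y hy ↦ ?_) m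
    exact antitoneOn_logSymbol_left (Ioo_subset_Ico_self hy) (Ioo_subset_Icc_self hx)
      (right_mem_Icc.2 hpi.le) hx.2.le
  have outer : ∀ n, |riemannSum g n - ∫ x in 0..π, g x| ≤ riemannError (fun _ ↦ g π) (g 0) n :=
    antitoneOn_integral_logSymbol.abs_riemannSum_sub_integral_le
      (fun x hx ↦ antitoneOn_integral_logSymbol (left_mem_Icc.2 hpi.le)
        (Ioo_subset_Icc_self hx) hx.1.le)
      intervalIntegrable_const
      (fun x hx ↦ antitoneOn_integral_logSymbol (Ioo_subset_Icc_self hx)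
        (right_mem_Icc.2 hpi.le) hx.2.le)
  have hbound : Tendsto (fun p : ℕ × ℕ ↦ π * riemannError (logSymbol π) (Real.log 8) p.2 +
      riemannError (fun _ ↦ g π) (g 0) p.1) (atTop ×ˢ atTop) (𝓝 0) := by
    have h1 := ((tendsto_riemannError (intervalIntegrable_logSymbol π 0 π)
      (Real.log 8)).const_mul π).comp (tendsto_snd (f := (atTop : Filter ℕ)))
    have h2 := (tendsto_riemannError (w := fun _ ↦ g π) intervalIntegrable_const
      (g 0)).comp (tendsto_fst (g := (atTop : Filter ℕ)))
    simpa [Function.comp_def] using h1.add h2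
  refine tendsto_iff_dist_tendsto_zero.2 (squeeze_zero (fun _ ↦ dist_nonneg) (fun p ↦ ?_) hbound)
  refine (dist_triangle _ (riemannSum g p.1) _).trans (add_le_add ?_ (outer p.1))
  exact abs_riemannSum_sub_riemannSum_le (inner p.2) p.1

/-- free energy.  As `n, m → ∞`,
`(1/(nm)) Σ_{k=1}^n Σ_{l=1}^m log (4 + 2cos(kπ/(n+1)) + 2cos(lπ/(m+1)))` converges to
`(1/π²) ∫₀^π ∫₀^π log (4 + 2cos x + 2cos y) dx dy`, in the sense that for every `ε > 0`
there is `N₀` such that the sum differs from the integral by less than `ε` whenever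
`n ≥ N₀` and `m ≥ N₀`. -/
theorem stmt18 :
    ∀ ε : ℝ, 0 < ε → ∃ N₀ : ℕ, ∀ n m : ℕ, N₀ ≤ n → N₀ ≤ m →
      |(1 / ((n : ℝ) * (m : ℝ))) *
          ∑ k ∈ Finset.Icc 1 n, ∑ l ∈ Finset.Icc 1 m,
            Real.log (4 + 2 * Real.cos ((k : ℝ) * π / ((n : ℝ) + 1))
              + 2 * Real.cos ((l : ℝ) * π / ((m : ℝ) + 1)))
        - (1 / π ^ 2) * ∫ x in (0 : ℝ)..π, ∫ y in (0 : ℝ)..π,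
            Real.log (4 + 2 * Real.cos x + 2 * Real.cos y)| < ε := by
  intro ε hε
  have hratio : Tendsto (fun n : ℕ ↦ ((n : ℝ) + 1) / n) atTop (𝓝 1) := by
    have := (tendsto_natCast_div_add_atTop (1 : ℝ)).inv₀ one_ne_zero
    rw [inv_one] at this
    exact this.congr fun n ↦ inv_div _ _
  have hlim := (((hratio.comp (tendsto_fst (g := (atTop : Filter ℕ)))).mul
    (hratio.comp (tendsto_snd (f := (atTop : Filter ℕ))))).mul
      tendsto_riemannSum_riemannSum_logSymbol).const_mul (1 / π ^ 2)
  rw [one_mul, one_mul, prod_atTop_atTop_eq] at hlim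
  obtain ⟨⟨a, b⟩, hab⟩ := eventually_atTop.1 (Metric.tendsto_nhds.1 hlim ε hε)
  refine ⟨max a b, fun n m hn hm ↦ ?_⟩
  have key := hab (n, m) ⟨(le_max_left a b).trans hn, (le_max_right a b).trans hm⟩
  rw [Real.dist_eq] at key
  convert key using 3
  · have hn1 : (n : ℝ) + 1 ≠ 0 := by positivity
    have hm1 : (m : ℝ) + 1 ≠ 0 := by positivity
    simp only [Function.comp_apply, riemannSum, logSymbol, ← Finset.mul_sum]
    generalize ∑ k ∈ Finset.Icc 1 n, ∑ l ∈ Finset.Icc 1 m, Real.log _ = S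
    field_simp
  · rfl
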